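/- Let T > 0 and let h : [0,T] × ℝ → ℝ be an L¹-Carathéodory function such that h(t,s) > 0 for a.e. t ∈ [0,T] and all s < 0. Then every solution u of u'' + h(t,u) = 0 on (0,T) with boundary conditions u'(T) = u'(0) and u(0) = 0 satisfies u(t) ≥ 0 for all t ∈ [0,T]. -/

import Mathlib

open MeasureTheory Set Filter

noncomputable section

/-- Lebesgue measure restricted to `[0,T]`. -/
def muT (T : ℝ) : Measure ℝ := volume.restrict (Icc 0 T)

/-- `u` is a solution of `u'' + h(t,u) = 0` on `[0,T]`: `u` is `C¹` on `[0,T]` with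
derivative `u'`, and `u'` is absolutely continuous with a.e. second derivative
`-h(t,u(t))`, expressed in integral form. -/
def IsSolutionODE1 (T : ℝ) (h : ℝ → ℝ → ℝ) (u u' : ℝ → ℝ) : Prop :=
  (∀ t ∈ Icc (0:ℝ) T, HasDerivWithinAt u (u' t) (Icc (0:ℝ) T) t) ∧
  IntegrableOn (fun s => h s (u s)) (Icc (0:ℝ) T) ∧
  (∀ t ∈ Icc (0:ℝ) T, u' t = u' 0 - ∫ s in (0:ℝ)..t, h s (u s))

/-- `h` is an `L¹`-Carathéodory function on `[0,T] × ℝ`. -/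
def IsL1Caratheodory2 (T : ℝ) (h : ℝ → ℝ → ℝ) : Prop :=
  (∀ s : ℝ, Measurable fun t => h t s) ∧
  (∀ᵐ t ∂(muT T), Continuous fun s => h t s) ∧
  (∀ R : ℝ, 0 < R → ∃ η : ℝ → ℝ, IntegrableOn η (Icc (0:ℝ) T) ∧
    ∀ᵐ t ∂(muT T), ∀ s : ℝ, |s| ≤ R → |h t s| ≤ η t)

section

variable {T : ℝ} {h : ℝ → ℝ → ℝ} {u u' : ℝ → ℝ}

theorem IsSolutionODE1.continuousOn (hsol : IsSolutionODE1 T h u u') :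
    ContinuousOn u (Icc 0 T) :=
  fun t ht => (hsol.1 t ht).continuousWithinAt

/-- The derivative of a solution strictly decreases where the solution is negative. -/
theorem IsSolutionODE1.deriv_lt_of_neg (hsol : IsSolutionODE1 T h u u')
    (hpos : ∀ᵐ t ∂(muT T), ∀ s : ℝ, s < 0 → 0 < h t s)
    {x y : ℝ} (hx : 0 ≤ x) (hxy : x < y) (hy : y ≤ T) (hneg : ∀ t ∈ Ioo x y, u t < 0) :
    u' y < u' x := by
  obtain ⟨-, hint, hftc⟩ := hsol
  have hii : ∀ a b, 0 ≤ a → a ≤ b → b ≤ T →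
      IntervalIntegrable (fun s => h s (u s)) volume a b := fun a b ha hab hb =>
    (intervalIntegrable_iff_integrableOn_Icc_of_le hab).2 (hint.mono_set (Icc_subset_Icc ha hb))
  have hsub := intervalIntegral.integral_add_adjacent_intervals
    (hii 0 x le_rfl hx (hxy.le.trans hy)) (hii x y hx hxy.le hy)
  have hae : ∀ᵐ t ∂(volume.restrict (Ioo x y)), 0 < h t (u t) := by
    have hpos' := ae_restrict_of_ae_restrict_of_subset
      (Ioo_subset_Icc_self.trans (Icc_subset_Icc hx hy)) hpos
    filter_upwards [hpos', ae_restrict_mem measurableSet_Ioo] with t ht hmem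
    exact ht _ (hneg t hmem)
  have hint_pos : 0 < ∫ t in x..y, h t (u t) := by
    rw [intervalIntegral.integral_of_le hxy.le, integral_Ioc_eq_integral_Ioo,
      integral_pos_iff_support_of_nonneg_ae (hae.mono fun _ ht => ht.le)
        (hint.mono_set (Ioo_subset_Icc_self.trans (Icc_subset_Icc hx hy)))]
    have hsupp : Function.support (fun t => h t (u t)) =ᵐ[volume.restrict (Ioo x y)] univ :=
      eventuallyEq_univ.2 (hae.mono fun _ ht => ht.ne')
    rw [measure_congr hsupp]
    simpa using hxy
  have h1 := hftc x ⟨hx, hxy.le.trans hy⟩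
  have h2 := hftc y ⟨hx.trans hxy.le, hy⟩
  linarith

theorem IsSolutionODE1.exists_deriv_eq_slope (hsol : IsSolutionODE1 T h u u')
    {x y : ℝ} (hx : 0 ≤ x) (hxy : x < y) (hy : y ≤ T) :
    ∃ c ∈ Ioo x y, u' c = (u y - u x) / (y - x) :=
  exists_hasDerivAt_eq_slope u u' hxy (hsol.continuousOn.mono (Icc_subset_Icc hx hy))
    fun c hc => (hsol.1 c ⟨hx.trans hc.1.le, hc.2.le.trans hy⟩).hasDerivAt
      (Icc_mem_nhds (hx.trans_lt hc.1) (hc.2.trans_le hy))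

/-- A solution that is nonnegative at `p` and negative at `t > p` has a last point in `[p,t)`
where it is nonnegative. -/
theorem IsSolutionODE1.exists_last_nonneg (hsol : IsSolutionODE1 T h u u')
    {p t : ℝ} (hp : 0 ≤ p) (hpt : p ≤ t) (htT : t ≤ T) (hup : 0 ≤ u p) (hut : u t < 0) :
    ∃ a, p ≤ a ∧ a < t ∧ 0 ≤ u a ∧ ∀ s ∈ Ioc a t, u s < 0 := by
  have hc : IsCompact (Icc p t ∩ u ⁻¹' Ici 0) := isCompact_Icc.of_isClosed_subset
    ((hsol.continuousOn.mono (Icc_subset_Icc hp htT)).preimage_isClosed_of_isClosed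
      isClosed_Icc isClosed_Ici) inter_subset_left
  obtain ⟨a, ⟨ha, hua⟩, hmax⟩ := hc.exists_isGreatest ⟨p, ⟨le_rfl, hpt⟩, hup⟩
  refine ⟨a, ha.1, lt_of_le_of_ne ha.2 ?_, hua, fun s hs => ?_⟩
  · rintro rfl
    exact hut.not_ge hua
  · by_contra! hus
    exact hs.1.not_ge (hmax ⟨⟨ha.1.trans hs.1.le, hs.2⟩, hus⟩)

/-- A solution that is negative at `t` and nonnegative at `q > t` has a first point in `(t,q]`
where it is nonnegative. -/
theorem IsSolutionODE1.exists_first_nonneg (hsol : IsSolutionODE1 T h u u')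
    {t q : ℝ} (ht : 0 ≤ t) (htq : t ≤ q) (hq : q ≤ T) (huq : 0 ≤ u q) (hut : u t < 0) :
    ∃ b, t < b ∧ b ≤ q ∧ 0 ≤ u b ∧ ∀ s ∈ Ico t b, u s < 0 := by
  have hc : IsCompact (Icc t q ∩ u ⁻¹' Ici 0) := isCompact_Icc.of_isClosed_subset
    ((hsol.continuousOn.mono (Icc_subset_Icc ht hq)).preimage_isClosed_of_isClosed
      isClosed_Icc isClosed_Ici) inter_subset_left
  obtain ⟨b, ⟨hb, hub⟩, hmin⟩ := hc.exists_isLeast ⟨q, ⟨htq, le_rfl⟩, huq⟩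
  refine ⟨b, lt_of_le_of_ne hb.1 ?_, hb.2, hub, fun s hs => ?_⟩
  · rintro rfl
    exact hut.not_ge hub
  · by_contra! hus
    exact hs.2.not_ge (hmin ⟨⟨hs.1, hs.2.le.trans hb.2⟩, hus⟩)

/-- A solution that is nonnegative at the endpoints of an interval is nonnegative on it. -/
theorem IsSolutionODE1.nonneg_of_nonneg_endpoints (hsol : IsSolutionODE1 T h u u')
    (hpos : ∀ᵐ t ∂(muT T), ∀ s : ℝ, s < 0 → 0 < h t s)
    {p q : ℝ} (hp : 0 ≤ p) (hq : q ≤ T) (hup : 0 ≤ u p) (huq : 0 ≤ u q) :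
    ∀ t ∈ Icc p q, 0 ≤ u t := by
  intro t ht
  by_contra! hut
  have ht0 : 0 ≤ t := hp.trans ht.1
  have htT : t ≤ T := ht.2.trans hq
  obtain ⟨a, hpa, hat, hua, hna⟩ := hsol.exists_last_nonneg hp ht.1 htT hup hut
  obtain ⟨b, htb, hbq, hub, hnb⟩ := hsol.exists_first_nonneg ht0 ht.2 hq huq hut
  obtain ⟨c, hc, hcs⟩ := hsol.exists_deriv_eq_slope (hp.trans hpa) hat htT
  obtain ⟨d, hd, hds⟩ := hsol.exists_deriv_eq_slope ht0 htb (hbq.trans hq)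
  have hc_neg : u' c < 0 := hcs ▸ div_neg_of_neg_of_pos (by linarith) (by linarith)
  have hd_pos : 0 < u' d := hds ▸ div_pos (by linarith) (by linarith)
  have hlt := hsol.deriv_lt_of_neg hpos (hp.trans (hpa.trans hc.1.le)) (hc.2.trans hd.1)
    (hd.2.le.trans (hbq.trans hq)) fun s hs => by
      rcases le_or_gt s t with hst | hst
      · exact hna s ⟨hc.1.trans hs.1, hst⟩
      · exact hnb s ⟨hst.le, hs.2.trans hd.2⟩
  linarith

/-- A solution that starts at zero and is nonnegative on `[0,a]` has nonnegative initial slope. -/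
theorem IsSolutionODE1.deriv_zero_nonneg (hsol : IsSolutionODE1 T h u u') {a : ℝ}
    (ha : 0 < a) (haT : a ≤ T) (hu0 : u 0 = 0) (hnonneg : ∀ t ∈ Icc 0 a, 0 ≤ u t) :
    0 ≤ u' 0 := by
  have hd : HasDerivWithinAt u (u' 0) (Ioi 0) 0 :=
    (hsol.1 0 ⟨le_rfl, ha.le.trans haT⟩).mono_of_mem_nhdsWithin
      (Icc_mem_nhdsGT (ha.trans_le haT))
  rw [hasDerivWithinAt_iff_tendsto_slope' (by simp)] at hd
  refine ge_of_tendsto hd ?_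
  filter_upwards [Ioo_mem_nhdsGT ha] with t ht
  rw [slope_def_field, hu0, sub_zero, sub_zero]
  exact div_nonneg (hnonneg t ⟨ht.1.le, ht.2.le⟩) ht.1.le

end

/-- **Maximum principle (i), boundary conditions `u'(T) = u'(0)`, `u(0) = 0`.** -/
theorem max_principle_nonneg_third_bc
    (T : ℝ) (hT : 0 < T) (h : ℝ → ℝ → ℝ)
    (hCar : IsL1Caratheodory2 T h)
    (hpos : ∀ᵐ t ∂(muT T), ∀ s : ℝ, s < 0 → 0 < h t s)
    (u u' : ℝ → ℝ) (hsol : IsSolutionODE1 T h u u')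
    (hbc1 : u' T = u' 0) (hbc2 : u 0 = 0) :
    ∀ t ∈ Icc (0:ℝ) T, 0 ≤ u t := by
  have huT : 0 ≤ u T := by
    by_contra! huT
    obtain ⟨a, ha, haT, hua, hneg⟩ :=
      hsol.exists_last_nonneg le_rfl hT.le le_rfl hbc2.ge huT
    rcases ha.eq_or_lt with rfl | ha
    · exact (hsol.deriv_lt_of_neg hpos le_rfl hT le_rfl
        fun s hs => hneg s ⟨hs.1, hs.2.le⟩).ne hbc1
    · have h0 := hsol.deriv_zero_nonneg ha haT.le hbc2
        (hsol.nonneg_of_nonneg_endpoints hpos le_rfl haT.le hbc2.ge hua)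
      obtain ⟨c, hc, hcs⟩ := hsol.exists_deriv_eq_slope ha.le haT le_rfl
      have hc_neg : u' c < 0 := hcs ▸ div_neg_of_neg_of_pos (by linarith) (by linarith)
      have hlt := hsol.deriv_lt_of_neg hpos (ha.le.trans hc.1.le) hc.2 le_rfl
        fun s hs => hneg s ⟨hc.1.trans hs.1, hs.2.le⟩
      linarith
  exact hsol.nonneg_of_nonneg_endpoints hpos le_rfl le_rfl hbc2.ge huT
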